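/- Let l ≥ 1 and T ∈ SYT((∞^l)). Then the number of tableaux U ∈ SYT((∞^l)) with jdt(U) = T equals l − k, where k is the number of rows i ∈ {1, …, l} such that the set { j ≥ 1 : T_{i,j} is dominated } is infinite. -/

import Mathlib

open scoped Classical

/-- A 0-based box `(i, j)` belongs to the infinite shape with `l` rows
(`l = ⊤` gives the shape `(∞^∞)`, `l = (l₀ : ℕ∞)` gives `(∞^l₀)`).
Throughout, boxes are 0-based: the paper's box `(i, j)` (with row `i ≥ 1` and
column `j ≥ 1`) corresponds to `(i - 1, j - 1)`. -/
def Box (l : ℕ∞) (b : ℕ × ℕ) : Prop := (b.1 : ℕ∞) < l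

/-- `T` is an infinite standard Young tableau of the shape given by `Box l`:
entries are positive integers on the shape (and the junk value `0` off the shape),
`T` is a bijection from the boxes of the shape onto the positive integers, and
`T` is strictly increasing along rows and columns. -/
structure IsSYT (l : ℕ∞) (T : ℕ × ℕ → ℕ) : Prop where
  zero_outside : ∀ b : ℕ × ℕ, ¬ Box l b → T b = 0
  pos : ∀ b : ℕ × ℕ, Box l b → 0 < T b
  inj : ∀ b c : ℕ × ℕ, Box l b → Box l c → T b = T c → b = c
  surj : ∀ n : ℕ, 0 < n → ∃ b : ℕ × ℕ, Box l b ∧ T b = n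
  row_lt : ∀ b : ℕ × ℕ, Box l b → T b < T (b.1, b.2 + 1)
  col_lt : ∀ b : ℕ × ℕ, Box l (b.1 + 1, b.2) → T b < T (b.1 + 1, b.2)

/-- The sliding path of the filling `T` inside the set `D` of boxes, started at the
box `c`: at each step the empty box moves to whichever of the boxes directly below
or directly to the right (among those belonging to `D`) carries the smaller entry;
if neither belongs to `D`, the path stays put (it has terminated). -/
noncomputable def slideFrom (D : ℕ × ℕ → Prop) (T : ℕ × ℕ → ℕ) (c : ℕ × ℕ) : ℕ → ℕ × ℕ
  | 0 => c
  | n + 1 =>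
      let b := slideFrom D T c n
      if D (b.1 + 1, b.2) ∧ D (b.1, b.2 + 1) then
        (if T (b.1 + 1, b.2) < T (b.1, b.2 + 1) then (b.1 + 1, b.2) else (b.1, b.2 + 1))
      else if D (b.1 + 1, b.2) then (b.1 + 1, b.2)
      else if D (b.1, b.2 + 1) then (b.1, b.2 + 1)
      else b

/-- The sliding path `p(T)`, 0-indexed: `slide D T n` is the paper's `p_{n+1}(T)`;
it lies on the antidiagonal `i + j = n` as long as the path has not terminated. -/
noncomputable def slide (D : ℕ × ℕ → Prop) (T : ℕ × ℕ → ℕ) : ℕ → ℕ × ℕ :=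
  slideFrom D T (0, 0)

/-- Jeu de taquin on the set of boxes `D`: the entry `1` in the box `(0,0)` is
deleted, entries slide backwards along the sliding path, and every entry is
decremented by `1`.  A box `b` lies on the sliding path iff
`slide D T (b.1 + b.2) = b`; if moreover the path terminates at `b` (which is only
possible for finite tableaux) the box `b` is vacated (junk value `0`). -/
noncomputable def jdt (D : ℕ × ℕ → Prop) (T : ℕ × ℕ → ℕ) : ℕ × ℕ → ℕ := fun b =>
  if slide D T (b.1 + b.2) = b then
    (if slide D T (b.1 + b.2 + 1) = b then 0
     else T (slide D T (b.1 + b.2 + 1)) - 1)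
  else T b - 1

/-- Extension of a 0-based filling to boxes indexed by `ℤ × ℤ`: value `0` outside. -/
noncomputable def entE (T : ℕ × ℕ → ℕ) (b : ℤ × ℤ) : ℕ :=
  if 0 ≤ b.1 ∧ 0 ≤ b.2 then T (b.1.toNat, b.2.toNat) else 0

/-- The entry of `T` in the (0-based, `ℤ`-indexed) box `b` is dominated:
`T b < T (b.1 - 1, b.2 + 1)`, entries in nonexistent boxes counting as `0`. -/
def Dominated (T : ℕ × ℕ → ℕ) (b : ℤ × ℤ) : Prop :=
  entE T b < entE T (b.1 - 1, b.2 + 1)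


theorem box_iff (l : ℕ) (b : ℕ × ℕ) : Box (l : ℕ∞) b ↔ b.1 < l := by
  simp [Box]

noncomputable def bk (T : ℕ × ℕ → ℕ) (b : ℕ × ℕ) : ℕ × ℕ :=
  if b.1 = 0 then (0, b.2 - 1) else if b.2 = 0 then (b.1 - 1, 0)
  else if T (b.1, b.2 - 1) < T (b.1 - 1, b.2) then (b.1 - 1, b.2) else (b.1, b.2 - 1)

structure GoodPath (l : ℕ) (T : ℕ × ℕ → ℕ) (p : ℕ → ℕ × ℕ) : Prop where
  sum : ∀ n, (p n).1 + (p n).2 = n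
  row : ∀ n, (p n).1 < l
  back : ∀ n, p n = bk T (p (n + 1))

noncomputable def mkU (l : ℕ) (T : ℕ × ℕ → ℕ) (p : ℕ → ℕ × ℕ) (b : ℕ × ℕ) : ℕ :=
  if b.1 < l then
    if p (b.1 + b.2) = b then
      if b.1 + b.2 = 0 then 1 else T (p (b.1 + b.2 - 1)) + 1
    else T b + 1
  else 0

theorem GoodPath.step {l T p} (h : GoodPath l T p) (n : ℕ) :
    (p (n + 1) = ((p n).1 + 1, (p n).2) ∧
      ((p n).2 = 0 ∨ T ((p n).1 + 1, (p n).2 - 1) < T (p n))) ∨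
    (p (n + 1) = ((p n).1, (p n).2 + 1) ∧
      ((p n).1 = 0 ∨ T ((p n).1 - 1, (p n).2 + 1) ≤ T (p n))) := by
  have h1 := h.back n
  have h2 := h.sum (n + 1)
  rcases hq : p (n + 1) with ⟨i, j⟩
  rw [hq] at h1 h2
  simp only [bk] at h1
  simp only at h2
  split_ifs at h1 with a1 a2 a3 <;> rw [h1]
  · right; subst a1; simp; omega
  · left; subst a2; simp; omega
  · left; simp; exact ⟨by omega, Or.inr (by rw [Nat.sub_add_cancel (by omega)]; exact a3)⟩
  · right; simp; exact ⟨by omega, Or.inr (by rw [Nat.sub_add_cancel (by omega)]; omega)⟩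

section
variable {l : ℕ} {T : ℕ × ℕ → ℕ} {p : ℕ → ℕ × ℕ}

theorem mkU_succ (h : GoodPath l T p) (n : ℕ) : mkU l T p (p (n + 1)) = T (p n) + 1 := by
  simp [mkU, h.row, h.sum]

theorem mkU_zero (h : GoodPath l T p) : mkU l T p (p 0) = 1 := by
  simp [mkU, h.row, h.sum]

theorem mkU_off {b : ℕ × ℕ} (hb : b.1 < l) (hp : ∀ n, p n ≠ b) : mkU l T p b = T b + 1 := by
  simp [mkU, hb, hp]

theorem rowlt (hT : IsSYT (l : ℕ∞) T) {i j : ℕ} (hi : i < l) : T (i, j) < T (i, j + 1) :=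
  hT.row_lt (i, j) ((box_iff _ _).2 hi)

theorem collt (hT : IsSYT (l : ℕ∞) T) {i j : ℕ} (hi : i + 1 < l) : T (i, j) < T (i + 1, j) :=
  hT.col_lt (i, j) ((box_iff _ _).2 hi)

theorem path_lt (hT : IsSYT (l : ℕ∞) T) (h : GoodPath l T p) (n : ℕ) : T (p n) < T (p (n + 1)) := by
  have hr := h.row (n + 1)
  have hr0 := h.row n
  rcases h.step n with ⟨h1, -⟩ | ⟨h1, -⟩
  · rw [h1] at hr ⊢; exact collt hT hr
  · rw [h1]; exact rowlt hT hr0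

theorem mkU_le (hT : IsSYT (l : ℕ∞) T) (h : GoodPath l T p) (n : ℕ) :
    mkU l T p (p n) ≤ T (p n) := by
  cases n with
  | zero => rw [mkU_zero h]; exact hT.pos _ ((box_iff _ _).2 (h.row 0))
  | succ n => rw [mkU_succ h]; exact path_lt hT h n

/-- the path is injective in n -/
theorem path_inj (h : GoodPath l T p) {m n : ℕ} (e : p m = p n) : m = n := by
  rw [← h.sum m, ← h.sum n, e]

theorem mkU_SYT (hT : IsSYT (l : ℕ∞) T) (h : GoodPath l T p) : IsSYT (l : ℕ∞) (mkU l T p) := by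
  have tinj : ∀ b c : ℕ × ℕ, b.1 < l → c.1 < l → T b = T c → b = c := fun b c hb hc =>
    hT.inj b c ((box_iff _ _).2 hb) ((box_iff _ _).2 hc)
  have tpos : ∀ b : ℕ × ℕ, b.1 < l → 0 < T b := fun b hb => hT.pos b ((box_iff _ _).2 hb)
  constructor
  · intro b hb
    rw [box_iff] at hb
    simp [mkU, hb]
  · intro b hb
    rw [box_iff] at hb
    simp only [mkU, hb]
    split_ifs <;> simp
  · intro b c hb hc e
    rw [box_iff] at hb hc
    by_cases hbp : ∃ n, p n = b <;> by_cases hcp : ∃ n, p n = c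
    · obtain ⟨n, rfl⟩ := hbp
      obtain ⟨m, rfl⟩ := hcp
      cases n with
      | zero =>
        cases m with
        | zero => rfl
        | succ m =>
          rw [mkU_zero h, mkU_succ h] at e
          have := tpos _ (h.row m)
          omega
      | succ n =>
        cases m with
        | zero =>
          rw [mkU_zero h, mkU_succ h] at e
          have := tpos _ (h.row n)
          omega
        | succ m =>
          rw [mkU_succ h, mkU_succ h] at e
          have := path_inj h (tinj _ _ (h.row n) (h.row m) (by omega))
          rw [this]
    · obtain ⟨n, rfl⟩ := hbp
      push Not at hcp
      rw [mkU_off hc hcp] at e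
      cases n with
      | zero => rw [mkU_zero h] at e; have := tpos _ hc; omega
      | succ n =>
        rw [mkU_succ h] at e
        exact absurd (tinj _ _ (h.row n) hc (by omega)) (hcp n)
    · obtain ⟨n, rfl⟩ := hcp
      push Not at hbp
      rw [mkU_off hb hbp] at e
      cases n with
      | zero => rw [mkU_zero h] at e; have := tpos _ hb; omega
      | succ n =>
        rw [mkU_succ h] at e
        exact absurd (tinj _ _ (h.row n) hb (by omega)) (hbp n)
    · push Not at hbp hcp
      rw [mkU_off hb hbp, mkU_off hc hcp] at e
      exact tinj _ _ hb hc (by omega)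
  · intro n hn
    rcases Nat.lt_or_ge 1 n with h1 | h1
    · obtain ⟨b, hb, e⟩ := hT.surj (n - 1) (by omega)
      rw [box_iff] at hb
      by_cases hbp : ∃ n, p n = b
      · obtain ⟨m, rfl⟩ := hbp
        exact ⟨p (m + 1), (box_iff _ _).2 (h.row _), by rw [mkU_succ h]; omega⟩
      · push Not at hbp
        exact ⟨b, (box_iff _ _).2 hb, by rw [mkU_off hb hbp]; omega⟩
    · exact ⟨p 0, (box_iff _ _).2 (h.row _), by rw [mkU_zero h]; omega⟩
  · rintro ⟨i, j⟩ hb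
    rw [box_iff] at hb
    simp only at hb ⊢
    have hT1 := rowlt hT (j := j) hb
    by_cases hcp : ∃ n, p n = (i, j + 1)
    · obtain ⟨n, hn⟩ := hcp
      cases n with
      | zero => have := h.sum 0; rw [hn] at this; simp at this
      | succ n =>
      rw [← hn, mkU_succ h]
      rcases h.step n with ⟨h1, h2⟩ | ⟨h1, h2⟩
      · rw [hn] at h1
        simp only [Prod.mk.injEq] at h1
        rw [← h1.1, ← h1.2] at h2
        have : ∀ m, p m ≠ (i, j) := by
          intro m hm
          have s1 := h.sum m
          have s2 := h.sum n
          rw [hm] at s1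
          simp only at s1
          have : m = n := by omega
          subst this
          rw [hm] at h1
          simp at h1
        rw [mkU_off hb this]
        simp at h2
        omega
      · rw [hn] at h1
        simp only [Prod.mk.injEq] at h1
        have e : p n = (i, j) := Prod.ext (by simp; omega) (by simp; omega)
        have := mkU_le hT h n
        rw [e] at this ⊢
        omega
    · push Not at hcp
      rw [mkU_off (b := (i, j + 1)) hb hcp]
      by_cases hbp : ∃ n, p n = (i, j)
      · obtain ⟨n, hn⟩ := hbp
        have := mkU_le hT h n
        rw [hn] at this
        omega
      · push Not at hbp
        rw [mkU_off hb hbp]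
        omega
  · rintro ⟨i, j⟩ hb
    rw [box_iff] at hb
    simp only at hb ⊢
    have hT1 := collt hT (j := j) hb
    have hi : i < l := by omega
    by_cases hcp : ∃ n, p n = (i + 1, j)
    · obtain ⟨n, hn⟩ := hcp
      cases n with
      | zero => have := h.sum 0; rw [hn] at this; simp at this
      | succ n =>
      rw [← hn, mkU_succ h]
      rcases h.step n with ⟨h1, h2⟩ | ⟨h1, h2⟩
      · rw [hn] at h1
        simp only [Prod.mk.injEq] at h1
        have e : p n = (i, j) := Prod.ext (by simp; omega) (by simp; omega)
        have := mkU_le hT h n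
        rw [e] at this ⊢
        omega
      · rw [hn] at h1
        simp only [Prod.mk.injEq] at h1
        rw [← h1.1, ← h1.2] at h2
        have : ∀ m, p m ≠ (i, j) := by
          intro m hm
          have s1 := h.sum m
          have s2 := h.sum n
          rw [hm] at s1
          simp only at s1
          have : m = n := by omega
          subst this
          rw [hm] at h1
          simp at h1
        rw [mkU_off hi this]
        simp at h2
        have h3 : T (i, j) ≠ T (p n) := fun e => this n (tinj _ _ hi (h.row n) e).symm
        omega
    · push Not at hcp
      rw [mkU_off (b := (i + 1, j)) hb hcp]
      by_cases hbp : ∃ n, p n = (i, j)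
      · obtain ⟨n, hn⟩ := hbp
        have := mkU_le hT h n
        rw [hn] at this
        omega
      · push Not at hbp
        rw [mkU_off (b := (i, j)) hi hbp]
        omega

theorem slide_succ_cases (U : ℕ × ℕ → ℕ) (n : ℕ) (hr : (slide (Box (l : ℕ∞)) U n).1 < l) :
    slide (Box (l : ℕ∞)) U (n + 1) =
      if (slide (Box (l : ℕ∞)) U n).1 + 1 < l ∧
        U ((slide (Box (l : ℕ∞)) U n).1 + 1, (slide (Box (l : ℕ∞)) U n).2) <
        U ((slide (Box (l : ℕ∞)) U n).1, (slide (Box (l : ℕ∞)) U n).2 + 1) then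
        ((slide (Box (l : ℕ∞)) U n).1 + 1, (slide (Box (l : ℕ∞)) U n).2) else
        ((slide (Box (l : ℕ∞)) U n).1, (slide (Box (l : ℕ∞)) U n).2 + 1) := by
  unfold slide at hr ⊢
  rw [slideFrom]
  simp only [box_iff, hr]
  split_ifs <;> simp_all

theorem mkU_slide (hT : IsSYT (l : ℕ∞) T) (h : GoodPath l T p) (n : ℕ) :
    slide (Box (l : ℕ∞)) (mkU l T p) n = p n := by
  induction n with
  | zero =>
    have := h.sum 0
    simp only [slide, slideFrom]
    exact Prod.ext (by simp; omega) (by simp; omega)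
  | succ n ih =>
    have off : ∀ c : ℕ × ℕ, c.1 + c.2 = n + 1 → c ≠ p (n + 1) → ∀ m, p m ≠ c := by
      rintro c hc hne m rfl
      rw [h.sum] at hc
      exact hne (by rw [hc])
    rw [slide_succ_cases _ _ (by rw [ih]; exact h.row n), ih]
    have hs := h.sum n
    have hr := h.row n
    have hr1 := h.row (n + 1)
    have hU := mkU_succ h n
    rcases h.step n with ⟨h1, -⟩ | ⟨h1, -⟩
    · rw [if_pos, h1]
      rw [h1] at hr1
      refine ⟨hr1, ?_⟩
      rw [← h1, hU, mkU_off (b := ((p n).1, (p n).2 + 1)) hr (off _ (by simp; omega) (by rw [h1]; simp))]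
      have := rowlt hT (j := (p n).2) hr
      simp at this
      omega
    · rw [if_neg, h1]
      rintro ⟨h3, h4⟩
      rw [← h1, hU, mkU_off (b := ((p n).1 + 1, (p n).2)) h3 (off _ (by simp; omega) (by rw [h1]; simp))] at h4
      have := collt hT (j := (p n).2) h3
      simp at this
      omega

theorem mkU_jdt (hT : IsSYT (l : ℕ∞) T) (h : GoodPath l T p) :
    jdt (Box (l : ℕ∞)) (mkU l T p) = T := by
  funext b
  simp only [jdt, mkU_slide hT h]
  by_cases hb : b.1 < l
  · split_ifs with h1 h2
    · have := congrArg (fun x : ℕ × ℕ => x.1 + x.2) h2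
      simp only [h.sum] at this
      omega
    · rw [mkU_succ h, h1]; rfl
    · rw [mkU_off hb]; rfl
      rintro m rfl
      rw [h.sum] at h1
      exact h1 rfl
  · have : p (b.1 + b.2) ≠ b := by
      intro e
      have := h.row (b.1 + b.2)
      rw [e] at this
      exact hb this
    rw [if_neg this, hT.zero_outside b (by rwa [box_iff])]
    simp [mkU, hb]

theorem slide_row_sum (hl : 1 ≤ l) (U : ℕ × ℕ → ℕ) (n : ℕ) :
    (slide (Box (l : ℕ∞)) U n).1 < l ∧
    (slide (Box (l : ℕ∞)) U n).1 + (slide (Box (l : ℕ∞)) U n).2 = n := by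
  induction n with
  | zero => simp [slide, slideFrom]; omega
  | succ n ih =>
    rw [slide_succ_cases _ _ ih.1]
    split_ifs with h1
    · simp; omega
    · simp; omega

theorem jdt_on (hl : 1 ≤ l) (U : ℕ × ℕ → ℕ) (hj : jdt (Box (l : ℕ∞)) U = T) (n : ℕ) :
    T (slide (Box (l : ℕ∞)) U n) = U (slide (Box (l : ℕ∞)) U (n + 1)) - 1 := by
  have h1 := slide_row_sum hl U n
  have h2 := slide_row_sum hl U (n + 1)
  rw [← hj]
  simp only [jdt, h1.2]
  simp only [if_true]
  rw [if_neg]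
  intro e
  rw [e] at h2
  omega

theorem jdt_off (hl : 1 ≤ l) (U : ℕ × ℕ → ℕ) (hj : jdt (Box (l : ℕ∞)) U = T) (b : ℕ × ℕ)
    (hb : slide (Box (l : ℕ∞)) U (b.1 + b.2) ≠ b) : T b = U b - 1 := by
  rw [← hj]
  simp only [jdt, if_neg hb]

theorem slide_good (hl : 1 ≤ l) (U : ℕ × ℕ → ℕ) (hU : IsSYT (l : ℕ∞) U)
    (hj : jdt (Box (l : ℕ∞)) U = T) : GoodPath l T (slide (Box (l : ℕ∞)) U) := by
  refine ⟨fun n => (slide_row_sum hl U n).2, fun n => (slide_row_sum hl U n).1, fun n => ?_⟩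
  have h1 := slide_row_sum hl U n
  have h2 := slide_row_sum hl U (n + 1)
  have hs := slide_succ_cases U n h1.1
  have hon := jdt_on hl U hj n
  have hoff := jdt_off hl U hj
  have upos : ∀ b : ℕ × ℕ, b.1 < l → 0 < U b := fun b hb => hU.pos b ((box_iff _ _).2 hb)
  rcases hp : slide (Box (l : ℕ∞)) U n with ⟨i, j⟩
  rw [hp] at h1 hs hon
  simp only at h1
  split_ifs at hs with h3
  · rw [hs] at hon ⊢
    simp only [bk]
    rw [if_neg (by omega)]
    by_cases hj0 : j = 0
    · subst hj0; simp
    · obtain ⟨k, rfl⟩ := Nat.exists_eq_succ_of_ne_zero hj0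
      rw [if_neg (by omega), if_pos]
      · simp
      · simp only [Nat.succ_eq_add_one, Nat.add_sub_cancel] at *
        rw [hon, hoff (i + 1, k)]
        · have := rowlt hU (i := i + 1) (j := k) h3.1
          have := upos (i + 1, k) h3.1
          omega
        · simp only
          rw [show i + 1 + k = n by omega, hp]
          simp
  · rw [hs] at hon ⊢
    simp only [bk]
    by_cases hi0 : i = 0
    · subst hi0; simp
    · obtain ⟨k, rfl⟩ := Nat.exists_eq_succ_of_ne_zero hi0
      rw [if_neg (by omega), if_neg (by omega), if_neg]
      · simp
      · simp only [Nat.succ_eq_add_one, Nat.add_sub_cancel] at *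
        rw [hon, hoff (k, j + 1)]
        · have := collt hU (i := k) (j := j + 1) h1.1
          omega
        · simp only
          rw [show k + (j + 1) = n by omega, hp]
          simp

theorem eq_mkU (hl : 1 ≤ l) (U : ℕ × ℕ → ℕ) (hU : IsSYT (l : ℕ∞) U)
    (hj : jdt (Box (l : ℕ∞)) U = T) : U = mkU l T (slide (Box (l : ℕ∞)) U) := by
  have hg := slide_good hl U hU hj
  have upos : ∀ b : ℕ × ℕ, b.1 < l → 0 < U b := fun b hb => hU.pos b ((box_iff _ _).2 hb)
  funext b
  by_cases hb : b.1 < l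
  · by_cases hp : slide (Box (l : ℕ∞)) U (b.1 + b.2) = b
    · rcases hn : b.1 + b.2 with _ | n
      · rw [hn] at hp
        rw [← hp, mkU_zero hg]
        -- the entry at the corner
        obtain ⟨c, hc, hc1⟩ := hU.surj 1 one_pos
        rw [box_iff] at hc
        have e0 : slide (Box (l : ℕ∞)) U 0 = (0, 0) := rfl
        rw [e0]
        rcases c with ⟨i, j⟩
        rcases i with _ | i
        · rcases j with _ | j
          · exact hc1
          · have := rowlt hU (i := 0) (j := j) hc
            have := upos (0, j) hc
            omega
        · have hi : i < l := by simp only at hc; omega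
          have := collt hU (i := i) (j := j) hc
          have := upos (i, j) hi
          omega
      · rw [hn] at hp
        rw [← hp, mkU_succ hg, jdt_on hl U hj]
        have := upos _ (hg.row (n + 1))
        omega
    · rw [mkU_off hb, jdt_off hl U hj b hp]
      · have := upos b hb
        omega
      · rintro m rfl
        rw [hg.sum] at hp
        exact hp rfl
  · rw [hU.zero_outside b (by rwa [box_iff])]
    simp [mkU, hb]

theorem path_eventually (h : GoodPath l T p) :
    ∃ r, r < l ∧ ∃ N, ∀ n, p (r + N + n) = (r, N + n) := by
  have hm : Monotone (fun n => (p n).1) := by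
    refine monotone_nat_of_le_succ fun n => ?_
    rcases h.step n with ⟨h1, -⟩ | ⟨h1, -⟩ <;> rw [h1] <;> simp
  have hbd : ∀ k, (∃ n, l ≤ (p n).1 + k) → ∃ N, ∀ n, N ≤ n → (p n).1 = (p N).1 := by
    intro k
    induction k with
    | zero => rintro ⟨n, hn⟩; have := h.row n; omega
    | succ k ih =>
      rintro ⟨n, hn⟩
      by_cases hk : ∃ n, l ≤ (p n).1 + k
      · exact ih hk
      · push Not at hk
        refine ⟨n, fun m hm' => ?_⟩
        have := hk m
        have := hm hm'
        simp only at this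
        omega
  obtain ⟨N, hN⟩ := hbd l ⟨0, by omega⟩
  refine ⟨(p N).1, h.row N, N, fun n => ?_⟩
  have h1 := hN ((p N).1 + N + n) (by omega)
  have h2 := h.sum ((p N).1 + N + n)
  exact Prod.ext h1 (by simp only; omega)

theorem not_dom (i j : ℕ) : ¬ Dominated T ((i : ℤ), (j : ℤ)) ↔ (i = 0 ∨ T (i - 1, j + 1) ≤ T (i, j)) := by
  rcases i with _ | i
  · simp [Dominated, entE]
  · have h1 : ((i : ℤ) + 1 - 1) = i := by ring
    have h2 : (0 : ℤ) ≤ (i : ℤ) + 1 := by omega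
    have h3 : (0 : ℤ) ≤ (j : ℤ) + 1 := by omega
    have h4 : ((i : ℤ) + 1).toNat = i + 1 := by omega
    have h5 : ((j : ℤ) + 1).toNat = j + 1 := by omega
    simp [Dominated, entE, h2, h3, h4, h5]

theorem path_finite (h : GoodPath l T p) {r N : ℕ} (hr : ∀ n, p (r + N + n) = (r, N + n)) :
    {j : ℕ | Dominated T ((r : ℤ), (j : ℤ))}.Finite := by
  refine (Set.finite_lt_nat N).subset fun j hj => ?_
  by_contra hc
  simp only [Set.mem_setOf_eq, not_lt] at hc hj
  refine absurd hj ((not_dom _ _).2 ?_)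
  obtain ⟨n, rfl⟩ := Nat.exists_eq_add_of_le hc
  have h0 := hr n
  have h1 := hr (n + 1)
  rcases h.step (r + N + n) with ⟨h2, -⟩ | ⟨-, h3⟩
  · rw [h0, show r + N + n + 1 = r + N + (n + 1) by ring, h1] at h2
    simp at h2
  · rw [h0] at h3
    exact h3

theorem exists_path {r : ℕ} (hr : r < l) (hf : {j : ℕ | Dominated T ((r : ℤ), (j : ℤ))}.Finite) :
    ∃ p, GoodPath l T p ∧ ∃ N, ∀ n, p (r + N + n) = (r, N + n) := by
  obtain ⟨J, hJ⟩ := hf.bddAbove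
  have hnd : ∀ j, J < j → (r = 0 ∨ T (r - 1, j + 1) ≤ T (r, j)) := by
    intro j hj
    rw [← not_dom]
    intro hd
    have := hJ hd
    omega
  have hb : ∀ j, J < j → bk T (r, j + 1) = (r, j) := by
    intro j hj
    rcases hnd j hj with h | h
    · simp [bk, h]
    · simp only [bk]
      split_ifs with h1 h2 h3
      · simp [h1]
      · simp at h2
      · simp at h3; omega
      · simp
  have hbm : ∀ m j, J < j → (bk T)^[m] (r, j + m) = (r, j) := by
    intro m
    induction m with
    | zero => intro j _; rfl
    | succ m ih =>
      intro j hj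
      rw [Function.iterate_succ_apply, show j + (m + 1) = (j + m) + 1 by ring, hb _ (by omega), ih j hj]
  have hbs : ∀ m (b : ℕ × ℕ), ((bk T)^[m] b).1 + ((bk T)^[m] b).2 = b.1 + b.2 - m ∧
      ((bk T)^[m] b).1 ≤ b.1 := by
    intro m
    induction m with
    | zero => intro b; simp
    | succ m ih =>
      intro b
      rw [Function.iterate_succ_apply]
      have h1 := ih (bk T b)
      have h2 : (bk T b).1 + (bk T b).2 = b.1 + b.2 - 1 ∧ (bk T b).1 ≤ b.1 := by
        simp only [bk]
        split_ifs <;> simp <;> omega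
      omega
  refine ⟨fun n => (bk T)^[r + (J + 1)] (r, n + (J + 1)), ⟨?_, ?_, ?_⟩, J + 1, ?_⟩
  · intro n
    have := (hbs (r + (J + 1)) (r, n + (J + 1))).1
    simp only at this
    simp only [this]
    omega
  · intro n
    have := (hbs (r + (J + 1)) (r, n + (J + 1))).2
    simp only at this ⊢
    omega
  · intro n
    rw [← Function.iterate_succ_apply' (bk T), Function.iterate_succ_apply,
      show n + 1 + (J + 1) = (n + (J + 1)) + 1 by ring, hb _ (by omega)]
  · intro n
    simp only
    rw [show r + (J + 1) + n + (J + 1) = (J + 1 + n) + (r + (J + 1)) by ring, hbm _ _ (by omega)]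

theorem path_unique {q : ℕ → ℕ × ℕ} (hp : GoodPath l T p) (hq : GoodPath l T q) {r N M : ℕ}
    (h1 : ∀ n, p (r + N + n) = (r, N + n)) (h2 : ∀ n, q (r + M + n) = (r, M + n)) : p = q := by
  have key : ∀ k n, p (n + k) = q (n + k) → p n = q n := by
    intro k
    induction k with
    | zero => intro n h; exact h
    | succ k ih =>
      intro n h
      refine ih n ?_
      rw [hp.back, hq.back, show n + k + 1 = n + (k + 1) by ring, h]
  funext n
  refine key (r + N + M) n ?_
  rw [show n + (r + N + M) = r + N + (M + n) by ring, h1,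
    show r + N + (M + n) = r + M + (N + n) by ring, h2]
  congr 1
  ring

end

/-- For `l ≥ 1` and `T ∈ SYT((∞^l))`, the number of preimages of `T` under jeu de
taquin equals `l - k`, where `k` is the number of (0-based) rows `i < l` of `T`
containing infinitely many dominated entries. -/
theorem stmt_5 (l : ℕ) (hl : 1 ≤ l) (T : ℕ × ℕ → ℕ) (hT : IsSYT (l : ℕ∞) T) :
    {U : ℕ × ℕ → ℕ | IsSYT (l : ℕ∞) U ∧ jdt (Box (l : ℕ∞)) U = T}.Finite ∧
    {U : ℕ × ℕ → ℕ | IsSYT (l : ℕ∞) U ∧ jdt (Box (l : ℕ∞)) U = T}.ncard =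
      l - {i : ℕ | i < l ∧ {j : ℕ | Dominated T ((i : ℤ), (j : ℤ))}.Infinite}.ncard := by
  set R : Set ℕ := {i : ℕ | i < l ∧ {j : ℕ | Dominated T ((i : ℤ), (j : ℤ))}.Finite} with hR
  set K : Set ℕ := {i : ℕ | i < l ∧ {j : ℕ | Dominated T ((i : ℤ), (j : ℤ))}.Infinite} with hK
  have hex : ∀ r, ∃ p, r ∈ R → GoodPath l T p ∧ ∃ N, ∀ n, p (r + N + n) = (r, N + n) := by
    intro r
    by_cases hr : r ∈ R
    · obtain ⟨p, hp⟩ := exists_path hr.1 hr.2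
      exact ⟨p, fun _ => hp⟩
    · exact ⟨fun _ => (0, 0), fun h => absurd h hr⟩
  choose P hP using hex
  have himg : {U : ℕ × ℕ → ℕ | IsSYT (l : ℕ∞) U ∧ jdt (Box (l : ℕ∞)) U = T} =
      (fun r => mkU l T (P r)) '' R := by
    ext U
    simp only [Set.mem_setOf_eq, Set.mem_image]
    constructor
    · rintro ⟨hU, hj⟩
      have hg := slide_good hl U hU hj
      obtain ⟨r, hr, N, hN⟩ := path_eventually hg
      have hrR : r ∈ R := ⟨hr, path_finite hg hN⟩
      obtain ⟨hg', M, hM⟩ := hP r hrR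
      refine ⟨r, hrR, ?_⟩
      rw [path_unique hg' hg hM hN]
      exact (eq_mkU hl U hU hj).symm
    · rintro ⟨r, hr, rfl⟩
      exact ⟨mkU_SYT hT (hP r hr).1, mkU_jdt hT (hP r hr).1⟩
  have hinj : Set.InjOn (fun r => mkU l T (P r)) R := by
    intro r hr s hs e
    simp only at e
    have e2 : P r = P s := by
      funext n
      rw [← mkU_slide hT (hP r hr).1, e, mkU_slide hT (hP s hs).1]
    obtain ⟨-, N, hN⟩ := hP r hr
    obtain ⟨-, M, hM⟩ := hP s hs
    have h1 := hN (s + M)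
    have h2 := hM (r + N)
    rw [e2, show r + N + (s + M) = s + M + (r + N) by ring, h2] at h1
    simp only [Prod.mk.injEq] at h1
    exact h1.1.symm
  have hRf : R.Finite := (Set.finite_lt_nat l).subset fun i hi => hi.1
  have hKf : K.Finite := (Set.finite_lt_nat l).subset fun i hi => hi.1
  rw [himg]
  refine ⟨hRf.image _, ?_⟩
  rw [Set.ncard_image_of_injOn hinj]
  have hu : R ∪ K = Set.Iio l := by
    ext i
    simp only [hR, hK, Set.mem_union, Set.mem_setOf_eq, Set.mem_Iio, Set.Infinite]
    tauto
  have hd : Disjoint R K := by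
    rw [Set.disjoint_left]
    rintro i h1 h2
    exact h2.2 h1.2
  have hc := Set.ncard_union_eq hd hRf hKf
  rw [hu] at hc
  have : (Set.Iio l).ncard = l := by
    rw [← Finset.coe_Iio, Set.ncard_coe_finset]; simp
  omega
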